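/- arXiv:math/0302192 — 3 statements merged into one kernel-verified Lean document; each statement's English description precedes it below -/
import Mathlib

section
/- Let (Z,A,S) be a normal regular bivariate Birkhoff interpolation scheme in which Z is (p,q)-rectangular, and set n = (p+1)(q+1). Then for every lower set L ⊆ S one has n·|A ∩ L| ≥ |L| + pq·|A ∩ ∂L| + (p+q)·|A ∩ ∂_e L| + p·|A ∩ ∂_y L| + q·|A ∩ ∂_x L|. -/
open Finset

/-- A finite subset of `ℤ≥0²` is a *lower set* if it is closed under
coordinatewise decrease. -/
def IsLower (S : Finset (ℕ × ℕ)) : Prop :=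
  ∀ u v, (u, v) ∈ S → ∀ i j, i ≤ u → j ≤ v → (i, j) ∈ S

/-- The value at `(x,y)` of `∂^{i+j}P/∂x^i∂y^j`, where `P` is the polynomial
with coefficients `a` supported on `S`. -/
noncomputable def derivAt (S : Finset (ℕ × ℕ)) (a : ℕ × ℕ → ℝ) (i j : ℕ) (x y : ℝ) : ℝ :=
  ∑ uv ∈ S, a uv * (uv.1.descFactorial i : ℝ) * (uv.2.descFactorial j : ℝ) *
      x ^ (uv.1 - i) * y ^ (uv.2 - j)

/-- The bivariate Birkhoff scheme `(Z,A,S)` is *regular*: every interpolation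
problem has a unique solution in `P_S` (polynomials supported on `S`). -/
def Regular (Z : Finset (ℝ × ℝ)) (A S : Finset (ℕ × ℕ)) : Prop :=
  ∀ c : ℕ × ℕ → ℝ × ℝ → ℝ, ∃! a : ℕ × ℕ → ℝ,
    (∀ uv, uv ∉ S → a uv = 0) ∧
    ∀ z ∈ Z, ∀ ij ∈ A, derivAt S a ij.1 ij.2 z.1 z.2 = c ij z

/-- The scheme `(Z,A,S)` is *solvable*: every interpolation problem has at
least one solution in `P_S`. -/
def Solvable (Z : Finset (ℝ × ℝ)) (A S : Finset (ℕ × ℕ)) : Prop :=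
  ∀ c : ℕ × ℕ → ℝ × ℝ → ℝ, ∃ a : ℕ × ℕ → ℝ,
    (∀ uv, uv ∉ S → a uv = 0) ∧
    ∀ z ∈ Z, ∀ ij ∈ A, derivAt S a ij.1 ij.2 z.1 z.2 = c ij z

/-- `Z ⊂ ℝ²` is a `(p,q)`-rectangular set of nodes. -/
def IsRect (p q : ℕ) (Z : Finset (ℝ × ℝ)) : Prop :=
  ∃ x : Fin (p + 1) → ℝ, ∃ y : Fin (q + 1) → ℝ,
    Function.Injective x ∧ Function.Injective y ∧
    Z = (Finset.univ : Finset (Fin (p + 1) × Fin (q + 1))).image (fun ij => (x ij.1, y ij.2))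

/-- `B_x = {i : (i,0) ∈ B}`. -/
def setX (B : Finset (ℕ × ℕ)) : Finset ℕ := (B.filter fun ij => ij.2 = 0).image Prod.fst

/-- `B_y = {j : (0,j) ∈ B}`. -/
def setY (B : Finset (ℕ × ℕ)) : Finset ℕ := (B.filter fun ij => ij.1 = 0).image Prod.snd

/-- `B_x[β] = {α : (α,β) ∈ B}`. -/
def sliceX (B : Finset (ℕ × ℕ)) (b : ℕ) : Finset ℕ := (B.filter fun ij => ij.2 = b).image Prod.fst

/-- `B_y[α] = {β : (α,β) ∈ B}`. -/
def sliceY (B : Finset (ℕ × ℕ)) (a : ℕ) : Finset ℕ := (B.filter fun ij => ij.1 = a).image Prod.snd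

/-- Projection of the nodes on the OX axis. -/
noncomputable def nodesX (Z : Finset (ℝ × ℝ)) : Finset ℝ := Z.image Prod.fst

/-- Projection of the nodes on the OY axis. -/
noncomputable def nodesY (Z : Finset (ℝ × ℝ)) : Finset ℝ := Z.image Prod.snd

/-- The rectangle `R(u,v) = {(i,j) : i ≤ u, j ≤ v}`. -/
def rect (u v : ℕ) : Finset (ℕ × ℕ) := Finset.range (u + 1) ×ˢ Finset.range (v + 1)

/-- The blow-up `R^{p,q} = {(α,β) : (⌊α/(p+1)⌋, ⌊β/(q+1)⌋) ∈ R}`. -/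
def blowup (p q : ℕ) (R : Finset (ℕ × ℕ)) : Finset (ℕ × ℕ) :=
  (R ×ˢ (Finset.range (p + 1) ×ˢ Finset.range (q + 1))).image
    (fun x => ((p + 1) * x.1.1 + x.2.1, (q + 1) * x.1.2 + x.2.2))

/-- `n_{p,q}(L)`: number of `(α,β) ∈ L` with `(p+1) ∣ α` and `(q+1) ∣ β`. -/
def npq (p q : ℕ) (L : Finset (ℕ × ℕ)) : ℕ :=
  (L.filter fun ab => (p + 1) ∣ ab.1 ∧ (q + 1) ∣ ab.2).card

/-- Value at `x` of the `i`-th derivative of the univariate polynomial with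
coefficients `a` supported on `S`. -/
noncomputable def derivAt1 (S : Finset ℕ) (a : ℕ → ℝ) (i : ℕ) (x : ℝ) : ℝ :=
  ∑ u ∈ S, a u * (u.descFactorial i : ℝ) * x ^ (u - i)

/-- Regularity of the univariate Birkhoff scheme `(W,A,S)`. -/
def Regular1 (W : Finset ℝ) (A S : Finset ℕ) : Prop :=
  ∀ c : ℕ → ℝ → ℝ, ∃! a : ℕ → ℝ,
    (∀ u, u ∉ S → a u = 0) ∧
    ∀ w ∈ W, ∀ i ∈ A, derivAt1 S a i w = c i w

/-- `(A,S)` is almost regular with respect to `(p,q)`-rectangular sets of nodes. -/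
def AlmostRegular (p q : ℕ) (A S : Finset (ℕ × ℕ)) : Prop :=
  ∃ Z : Finset (ℝ × ℝ), IsRect p q Z ∧ Regular Z A S


/-- Boundary of a lower set: points `(u,v) ∈ L` with `(u+1,v+1) ∉ L`. -/
def bdry (L : Finset (ℕ × ℕ)) : Finset (ℕ × ℕ) :=
  L.filter fun uv => (uv.1 + 1, uv.2 + 1) ∉ L

/-- Exterior boundary points: boundary points with `(u,v+1) ∉ L` and `(u+1,v) ∉ L`. -/
def bdryE (L : Finset (ℕ × ℕ)) : Finset (ℕ × ℕ) :=
  L.filter fun uv => (uv.1 + 1, uv.2 + 1) ∉ L ∧ (uv.1, uv.2 + 1) ∉ L ∧ (uv.1 + 1, uv.2) ∉ L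

/-- `x`-direction boundary points: `(u+1,v) ∈ L` but `(u,v+1) ∉ L`. -/
def bdryX (L : Finset (ℕ × ℕ)) : Finset (ℕ × ℕ) :=
  L.filter fun uv => (uv.1 + 1, uv.2 + 1) ∉ L ∧ (uv.1, uv.2 + 1) ∉ L ∧ (uv.1 + 1, uv.2) ∈ L

/-- `y`-direction boundary points: `(u,v+1) ∈ L` but `(u+1,v) ∉ L`. -/
def bdryY (L : Finset (ℕ × ℕ)) : Finset (ℕ × ℕ) :=
  L.filter fun uv => (uv.1 + 1, uv.2 + 1) ∉ L ∧ (uv.1, uv.2 + 1) ∈ L ∧ (uv.1 + 1, uv.2) ∉ L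

section derivAtLemmas

variable {S L : Finset (ℕ × ℕ)} {a : ℕ × ℕ → ℝ} {i j : ℕ}

/-- `derivAt` as a linear functional of the coefficients. -/
noncomputable def derivAtLinear (S : Finset (ℕ × ℕ)) (i j : ℕ) (x y : ℝ) :
    (ℕ × ℕ → ℝ) →ₗ[ℝ] ℝ where
  toFun a := derivAt S a i j x y
  map_add' a b := by
    simp only [derivAt, Pi.add_apply, add_mul, Finset.sum_add_distrib]
  map_smul' c a := by
    simp only [derivAt, Pi.smul_apply, smul_eq_mul, mul_assoc, Finset.mul_sum, RingHom.id_apply]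

/-- On polynomials supported on a lower set `L`, the derivative of order `(i,j)` only involves
the monomials `x^(u-i) y^(v-j)` with `(u,v) ∈ L`, `i ≤ u`, `j ≤ v`. -/
theorem derivAt_eq_sum_filter (ha : ∀ uv, uv ∉ L → a uv = 0) (x y : ℝ) :
    derivAt S a i j x y =
      ∑ uv ∈ S with uv ∈ L ∧ i ≤ uv.1 ∧ j ≤ uv.2,
        a uv * (uv.1.descFactorial i : ℝ) * (uv.2.descFactorial j : ℝ) *
          x ^ (uv.1 - i) * y ^ (uv.2 - j) := by
  unfold derivAt
  refine (Finset.sum_filter_of_ne fun uv _ hne => ?_).symm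
  refine ⟨?_, ?_, ?_⟩ <;> by_contra h <;> apply hne
  · simp [ha uv h]
  · simp [Nat.descFactorial_of_lt (not_le.mp h)]
  · simp [Nat.descFactorial_of_lt (not_le.mp h)]

theorem derivAt_congr_left (hL : IsLower L) (ha : ∀ uv, uv ∉ L → a uv = 0)
    (h : (i + 1, j) ∉ L) (x x' y : ℝ) :
    derivAt S a i j x y = derivAt S a i j x' y := by
  rw [derivAt_eq_sum_filter ha, derivAt_eq_sum_filter ha]
  refine Finset.sum_congr rfl ?_
  rintro ⟨u, v⟩ huv
  obtain ⟨-, hm, hi, hj⟩ := Finset.mem_filter.mp huv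
  have hu : u - i = 0 := by
    by_contra hne
    exact h (hL u v hm _ _ (by omega) hj)
  simp only [hu, pow_zero]

theorem derivAt_congr_right (hL : IsLower L) (ha : ∀ uv, uv ∉ L → a uv = 0)
    (h : (i, j + 1) ∉ L) (x y y' : ℝ) :
    derivAt S a i j x y = derivAt S a i j x y' := by
  rw [derivAt_eq_sum_filter ha, derivAt_eq_sum_filter ha]
  refine Finset.sum_congr rfl ?_
  rintro ⟨u, v⟩ huv
  obtain ⟨-, hm, hi, hj⟩ := Finset.mem_filter.mp huv
  have hv : v - j = 0 := by
    by_contra hne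
    exact h (hL u v hm _ _ hi (by omega))
  simp only [hv, pow_zero]

/-- At a boundary point of `L`, the derivative is a sum of a function of `x` and one of `y`. -/
theorem derivAt_add_derivAt (hL : IsLower L) (ha : ∀ uv, uv ∉ L → a uv = 0)
    (h : (i + 1, j + 1) ∉ L) (x x' y y' : ℝ) :
    derivAt S a i j x y + derivAt S a i j x' y' =
      derivAt S a i j x y' + derivAt S a i j x' y := by
  simp only [derivAt_eq_sum_filter ha, ← Finset.sum_add_distrib]
  refine Finset.sum_congr rfl ?_
  rintro ⟨u, v⟩ huv
  obtain ⟨-, hm, hi, hj⟩ := Finset.mem_filter.mp huv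
  have huv : u - i = 0 ∨ v - j = 0 := by
    by_contra! hne
    exact h (hL u v hm _ _ (by omega) (by omega))
  rcases huv with hu | hv
  · simp only [hu, pow_zero]
    ring
  · simp only [hv, pow_zero]

end derivAtLemmas

/-- Nodes of the `(p+1) × (q+1)` grid which determine the values on the whole grid of the
derivative of order `ij` of a polynomial supported on `L`. -/
def determiningNodes (p q : ℕ) (L : Finset (ℕ × ℕ)) (ij : ℕ × ℕ) :
    Finset (Fin (p + 1) × Fin (q + 1)) :=
  if (ij.1 + 1, ij.2 + 1) ∈ L then Finset.univ
  else ({0} ×ˢ if (ij.1, ij.2 + 1) ∈ L then Finset.univ else {0}) ∪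
    (if (ij.1 + 1, ij.2) ∈ L then Finset.univ.erase 0 else ∅) ×ˢ {0}

theorem card_determiningNodes_le (p q : ℕ) (L : Finset (ℕ × ℕ)) (ij : ℕ × ℕ) :
    (determiningNodes p q L ij).card ≤
      if (ij.1 + 1, ij.2 + 1) ∈ L then (p + 1) * (q + 1)
      else (if (ij.1, ij.2 + 1) ∈ L then q + 1 else 1) + if (ij.1 + 1, ij.2) ∈ L then p else 0 := by
  unfold determiningNodes
  split_ifs <;> first
    | exact (Finset.card_union_le _ _).trans (by simp)
    | simp

theorem derivAt_eq_zero_of_determiningNodes {p q : ℕ} {S L : Finset (ℕ × ℕ)} {a : ℕ × ℕ → ℝ}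
    {ij : ℕ × ℕ} (hL : IsLower L) (ha : ∀ uv, uv ∉ L → a uv = 0)
    (x : Fin (p + 1) → ℝ) (y : Fin (q + 1) → ℝ)
    (h : ∀ k ∈ determiningNodes p q L ij, derivAt S a ij.1 ij.2 (x k.1) (y k.2) = 0)
    (k : Fin (p + 1)) (l : Fin (q + 1)) : derivAt S a ij.1 ij.2 (x k) (y l) = 0 := by
  by_cases hd : (ij.1 + 1, ij.2 + 1) ∈ L
  · exact h (k, l) (by simp [determiningNodes, hd])
  have h00 : derivAt S a ij.1 ij.2 (x 0) (y 0) = 0 :=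
    h (0, 0) (by simp only [determiningNodes, hd]; split_ifs <;> simp)
  have hy : derivAt S a ij.1 ij.2 (x 0) (y l) = 0 := by
    by_cases hv : (ij.1, ij.2 + 1) ∈ L
    · exact h (0, l) (by simp [determiningNodes, hd, hv])
    · rw [derivAt_congr_right hL ha hv _ _ (y 0), h00]
  have hx : derivAt S a ij.1 ij.2 (x k) (y 0) = 0 := by
    by_cases hu : (ij.1 + 1, ij.2) ∈ L
    · by_cases hk : k = 0
      · rw [hk, h00]
      · exact h (k, 0) (by simp [determiningNodes, hd, hu, hk])
    · rw [derivAt_congr_left hL ha hu _ (x 0), h00]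
  have := derivAt_add_derivAt (S := S) hL ha hd (x k) (x 0) (y l) (y 0)
  linarith

theorem Regular.eq_zero {Z : Finset (ℝ × ℝ)} {A S : Finset (ℕ × ℕ)} (hreg : Regular Z A S)
    {a : ℕ × ℕ → ℝ} (ha : ∀ uv, uv ∉ S → a uv = 0)
    (h : ∀ z ∈ Z, ∀ ij ∈ A, derivAt S a ij.1 ij.2 z.1 z.2 = 0) : a = 0 :=
  (hreg fun _ _ => 0).unique ⟨ha, h⟩ ⟨fun _ _ => rfl, fun _ _ _ _ => by simp [derivAt]⟩

theorem Regular.card_le_sum_determiningNodes {p q : ℕ} {Z : Finset (ℝ × ℝ)}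
    {A S L : Finset (ℕ × ℕ)} (hreg : Regular Z A S) (hZ : IsRect p q Z) (hLS : L ⊆ S)
    (hL : IsLower L) : L.card ≤ ∑ ij ∈ A ∩ L, (determiningNodes p q L ij).card := by
  obtain ⟨x, y, -, -, rfl⟩ := hZ
  let T := (A ∩ L).sigma (determiningNodes p q L)
  let E := Function.ExtendByZero.linearMap ℝ (Subtype.val : L → ℕ × ℕ)
  let F : (L → ℝ) →ₗ[ℝ] (T → ℝ) := LinearMap.pi fun t =>
    derivAtLinear S t.1.1.1 t.1.1.2 (x t.1.2.1) (y t.1.2.2) ∘ₗ E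
  have hF : Function.Injective F := by
    rw [injective_iff_map_eq_zero]
    intro c hc
    have hE : ∀ uv, uv ∉ L → E c uv = 0 := fun uv huv =>
      Function.extend_apply' _ _ _ (by rintro ⟨w, rfl⟩; exact huv w.2)
    have hEc : E c = 0 := by
      refine hreg.eq_zero (fun uv huv => hE uv fun h => huv (hLS h)) ?_
      intro z hz ij hij
      obtain ⟨⟨k, l⟩, -, rfl⟩ := Finset.mem_image.mp hz
      by_cases hm : ij ∈ L
      · refine derivAt_eq_zero_of_determiningNodes hL hE x y (fun kl hkl => ?_) k l
        exact congrFun hc ⟨⟨ij, kl⟩,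
          Finset.mem_sigma.mpr ⟨Finset.mem_inter.mpr ⟨hij, hm⟩, hkl⟩⟩
      · rw [derivAt_eq_sum_filter hE, Finset.filter_false_of_mem, Finset.sum_empty]
        rintro uv - ⟨huv, hi, hj⟩
        exact hm (hL _ _ huv _ _ hi hj)
    funext w
    have := congrFun hEc w.1
    rwa [show E c w.1 = c w from Subtype.val_injective.extend_apply _ _ _] at this
  simpa [T] using LinearMap.finrank_le_finrank_of_injective hF

/-- strengthened Polya inequalities for regular schemes with
`(p,q)`-rectangular sets of nodes. -/
theorem polya_rectangular (p q : ℕ) (Z : Finset (ℝ × ℝ)) (A S : Finset (ℕ × ℕ))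
    (hZ : IsRect p q Z) (hS : IsLower S) (hnorm : S.card = Z.card * A.card)
    (hreg : Regular Z A S) :
    ∀ L ⊆ S, IsLower L →
      L.card + p * q * (A ∩ bdry L).card + (p + q) * (A ∩ bdryE L).card +
          p * (A ∩ bdryY L).card + q * (A ∩ bdryX L).card ≤
        (p + 1) * (q + 1) * (A ∩ L).card := by
  intro L hLS hL
  have hcard : ∀ (P : ℕ × ℕ → Prop) [DecidablePred P],
      (A ∩ L.filter P).card = ∑ ij ∈ A ∩ L, if P ij then 1 else 0 := fun P _ => by
    rw [Finset.inter_filter, Finset.card_filter]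
  have hle := hreg.card_le_sum_determiningNodes hZ hLS hL
  refine (Nat.add_le_add_right (Nat.add_le_add_right (Nat.add_le_add_right
    (Nat.add_le_add_right hle _) _) _) _).trans ?_
  simp only [bdry, bdryE, bdryX, bdryY, hcard, Finset.mul_sum, ← Finset.sum_add_distrib]
  rw [mul_comm (_ * _) (Finset.card _), ← smul_eq_mul (Finset.card _), ← Finset.sum_const]
  refine Finset.sum_le_sum fun ij _ => ?_
  have hc := card_determiningNodes_le p q L ij
  split_ifs at hc ⊢ <;> first | (simp_all; done) | (simp_all; linarith)
end

section
/- Let (Z,A,S) be a normal bivariate Birkhoff interpolation scheme in which Z is (p,q)-rectangular, and suppose the lower set S_y(A) associated to A is the rectangle R(s,t). Then (Z,A,S) is regular if and only if all of the following hold: (i) S = R(p',q') with p' = (s+1)(p+1)−1 and q' = (t+1)(q+1)−1; (ii) the univariate scheme (Z_x, A_x, S_x) is regular; (iii) for every α ∈ A_x, the univariate scheme (Z_y, A_y[α], S_y) is regular. -/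
open Finset

section FiniteLinearSystem

variable {ι κ : Type*} {S : Finset ι} {D : Finset κ} {M : κ → ι → ℝ}

/-- The linear map from coefficient vectors on `S` to data on `D` given by the matrix `M`. -/
noncomputable def dataMap (S : Finset ι) (D : Finset κ) (M : κ → ι → ℝ) :
    (S → ℝ) →ₗ[ℝ] (D → ℝ) :=
  Matrix.mulVecLin (Matrix.of fun (k : D) (u : S) => M k u)

lemma dataMap_restrict (a : ι → ℝ) (k : D) :
    dataMap S D M (fun u => a u) k = ∑ u ∈ S, M k u * a u := by
  rw [← Finset.sum_coe_sort S]
  rfl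

lemma exists_extension (b : S → ℝ) :
    ∃ a : ι → ℝ, (∀ u ∉ S, a u = 0) ∧ (fun u : S => a u) = b := by
  classical
  refine ⟨fun u => if h : u ∈ S then b ⟨u, h⟩ else 0, fun u hu => dif_neg hu, ?_⟩
  funext u
  simp

lemma dataMap_injective
    (hinj : ∀ a : ι → ℝ, (∀ u ∉ S, a u = 0) → (∀ k ∈ D, ∑ u ∈ S, M k u * a u = 0) → a = 0) :
    Function.Injective (dataMap S D M) := by
  rw [injective_iff_map_eq_zero]
  intro b hb
  obtain ⟨a, ha, rfl⟩ := exists_extension b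
  have : a = 0 := hinj a ha fun k hk => by
    rw [← dataMap_restrict a ⟨k, hk⟩, hb]
    rfl
  rw [this]
  rfl

lemma card_le_of_trivial_kernel
    (hinj : ∀ a : ι → ℝ, (∀ u ∉ S, a u = 0) → (∀ k ∈ D, ∑ u ∈ S, M k u * a u = 0) → a = 0) :
    S.card ≤ D.card := by
  simpa using LinearMap.finrank_le_finrank_of_injective (dataMap_injective hinj)

lemma existsUnique_of_trivial_kernel (hcard : S.card = D.card)
    (hinj : ∀ a : ι → ℝ, (∀ u ∉ S, a u = 0) → (∀ k ∈ D, ∑ u ∈ S, M k u * a u = 0) → a = 0)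
    (c : κ → ℝ) :
    ∃! a : ι → ℝ, (∀ u ∉ S, a u = 0) ∧ ∀ k ∈ D, ∑ u ∈ S, M k u * a u = c k := by
  have hsurj := (LinearMap.injective_iff_surjective_of_finrank_eq_finrank
    (by simpa using hcard)).1 (dataMap_injective hinj)
  obtain ⟨b, hb⟩ := hsurj fun k => c k
  obtain ⟨a, ha, rfl⟩ := exists_extension b
  have hac : ∀ k ∈ D, ∑ u ∈ S, M k u * a u = c k := fun k hk => by
    rw [← dataMap_restrict a ⟨k, hk⟩, hb]
  refine ⟨a, ⟨ha, hac⟩, fun a' ⟨ha', hac'⟩ => sub_eq_zero.1 (hinj (a' - a) ?_ ?_)⟩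
  · intro u hu
    simp [ha u hu, ha' u hu]
  · intro k hk
    simp [mul_sub, hac k hk, hac' k hk]

end FiniteLinearSystem

section Kernels

variable {Z : Finset (ℝ × ℝ)} {A S : Finset (ℕ × ℕ)} {W : Finset ℝ} {B T : Finset ℕ}

/-- Homogeneous interpolation in `P_S` has only the trivial solution. -/
def TrivialKernel (Z : Finset (ℝ × ℝ)) (A S : Finset (ℕ × ℕ)) : Prop :=
  ∀ a : ℕ × ℕ → ℝ, (∀ uv ∉ S, a uv = 0) →
    (∀ z ∈ Z, ∀ ij ∈ A, derivAt S a ij.1 ij.2 z.1 z.2 = 0) → a = 0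

/-- Univariate homogeneous interpolation has only the trivial solution. -/
def TrivialKernel1 (W : Finset ℝ) (B T : Finset ℕ) : Prop :=
  ∀ a : ℕ → ℝ, (∀ u ∉ T, a u = 0) →
    (∀ w ∈ W, ∀ i ∈ B, derivAt1 T a i w = 0) → a = 0

lemma Regular.trivialKernel (h : Regular Z A S) : TrivialKernel Z A S := fun _ ha h0 =>
  (h fun _ _ => 0).unique ⟨ha, h0⟩ ⟨fun _ _ => rfl, fun _ _ _ _ => by simp [derivAt]⟩

lemma Regular1.trivialKernel1 (h : Regular1 W B T) : TrivialKernel1 W B T := fun _ ha h0 =>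
  (h fun _ _ => 0).unique ⟨ha, h0⟩ ⟨fun _ _ => rfl, fun _ _ _ _ => by simp [derivAt1]⟩

lemma Finset.forall_mem_product_iff {ι κ : Type*} {s : Finset ι} {t : Finset κ}
    {P : ι × κ → Prop} : (∀ k ∈ s ×ˢ t, P k) ↔ ∀ i ∈ s, ∀ j ∈ t, P (i, j) := by
  simp only [Finset.mem_product, Prod.forall, and_imp]
  exact forall_congr' fun _ => forall_comm

lemma derivAt_eq_sum (a : ℕ × ℕ → ℝ) (i j : ℕ) (x y : ℝ) :
    derivAt S a i j x y = ∑ uv ∈ S, ((uv.1.descFactorial i : ℝ) * (uv.2.descFactorial j : ℝ) *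
      x ^ (uv.1 - i) * y ^ (uv.2 - j)) * a uv :=
  Finset.sum_congr rfl fun _ _ => by ring

lemma derivAt1_eq_sum (a : ℕ → ℝ) (i : ℕ) (x : ℝ) :
    derivAt1 T a i x = ∑ u ∈ T, ((u.descFactorial i : ℝ) * x ^ (u - i)) * a u :=
  Finset.sum_congr rfl fun _ _ => by ring

lemma TrivialKernel.regular (h : TrivialKernel Z A S) (hcard : S.card = Z.card * A.card) :
    Regular Z A S := by
  intro c
  have := existsUnique_of_trivial_kernel (S := S) (D := Z ×ˢ A)
    (M := fun k uv => (uv.1.descFactorial k.2.1 : ℝ) * (uv.2.descFactorial k.2.2 : ℝ) *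
      k.1.1 ^ (uv.1 - k.2.1) * k.1.2 ^ (uv.2 - k.2.2)) (by simpa using hcard)
    (fun a ha h0 => h a ha fun z hz ij hij => by
      rw [derivAt_eq_sum]; exact h0 (z, ij) (Finset.mk_mem_product hz hij))
    (fun k => c k.2 k.1)
  simpa only [Finset.forall_mem_product_iff, ← derivAt_eq_sum] using this

lemma TrivialKernel1.card_le (h : TrivialKernel1 W B T) : T.card ≤ W.card * B.card := by
  rw [← Finset.card_product]
  exact card_le_of_trivial_kernel (M := fun k u => (u.descFactorial k.2 : ℝ) * k.1 ^ (u - k.2))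
    fun a ha h0 => h a ha fun w hw i hi => by
      rw [derivAt1_eq_sum]; exact h0 (w, i) (Finset.mk_mem_product hw hi)

lemma TrivialKernel1.regular1 (h : TrivialKernel1 W B T) (hcard : T.card = W.card * B.card) :
    Regular1 W B T := by
  intro c
  have := existsUnique_of_trivial_kernel (S := T) (D := W ×ˢ B)
    (M := fun k u => (u.descFactorial k.2 : ℝ) * k.1 ^ (u - k.2)) (by simpa using hcard)
    (fun a ha h0 => h a ha fun w hw i hi => by
      rw [derivAt1_eq_sum]; exact h0 (w, i) (Finset.mk_mem_product hw hi))
    (fun k => c k.2 k.1)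
  simpa only [Finset.forall_mem_product_iff, ← derivAt1_eq_sum] using this

lemma mem_setX {u : ℕ} : u ∈ setX S ↔ (u, 0) ∈ S := by
  simp [setX]

lemma mem_setY {v : ℕ} : v ∈ setY S ↔ (0, v) ∈ S := by
  simp [setY]

lemma mem_sliceY {a v : ℕ} : v ∈ sliceY S a ↔ (a, v) ∈ S := by
  simp [sliceY]

lemma derivAt_of_fst (a : ℕ → ℝ) (i j : ℕ) (x y : ℝ) :
    derivAt S (fun uv => if uv.2 = 0 then a uv.1 else 0) i j x y =
      if j = 0 then derivAt1 (setX S) a i x else 0 := by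
  have hinj : Set.InjOn Prod.fst (S.filter fun ij : ℕ × ℕ => ij.2 = 0 : Set (ℕ × ℕ)) := by
    rintro ⟨u, v⟩ h ⟨u', v'⟩ h' huu
    simp_all
  have : derivAt S (fun uv => if uv.2 = 0 then a uv.1 else 0) i j x y =
      ∑ uv ∈ S with uv.2 = 0, a uv.1 * (uv.1.descFactorial i : ℝ) * (Nat.descFactorial 0 j : ℝ) *
        x ^ (uv.1 - i) := by
    rw [derivAt, Finset.sum_filter]
    refine Finset.sum_congr rfl fun uv _ => ?_
    split_ifs with h
    · simp [h]
    · simp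
  rw [this]
  split_ifs with hj
  · subst hj
    rw [derivAt1, setX, Finset.sum_image hinj]
    simp
  · obtain ⟨j, rfl⟩ := Nat.exists_eq_succ_of_ne_zero hj
    simp

lemma derivAt_of_snd (a : ℕ → ℝ) (i j : ℕ) (x y : ℝ) :
    derivAt S (fun uv => if uv.1 = 0 then a uv.2 else 0) i j x y =
      if i = 0 then derivAt1 (setY S) a j y else 0 := by
  have hinj : Set.InjOn Prod.snd (S.filter fun ij : ℕ × ℕ => ij.1 = 0 : Set (ℕ × ℕ)) := by
    rintro ⟨u, v⟩ h ⟨u', v'⟩ h' huu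
    simp_all
  have : derivAt S (fun uv => if uv.1 = 0 then a uv.2 else 0) i j x y =
      ∑ uv ∈ S with uv.1 = 0, a uv.2 * (Nat.descFactorial 0 i : ℝ) * (uv.2.descFactorial j : ℝ) *
        y ^ (uv.2 - j) := by
    rw [derivAt, Finset.sum_filter]
    refine Finset.sum_congr rfl fun uv _ => ?_
    split_ifs with h
    · simp [h]
    · simp
  rw [this]
  split_ifs with hi
  · subst hi
    rw [derivAt1, setY, Finset.sum_image hinj]
    simp
  · obtain ⟨i, rfl⟩ := Nat.exists_eq_succ_of_ne_zero hi
    simp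

lemma TrivialKernel.axisX (h : TrivialKernel Z A S) :
    TrivialKernel1 (nodesX Z) (setX A) (setX S) := by
  intro a ha h0
  have := h (fun uv => if uv.2 = 0 then a uv.1 else 0)
    (by
      rintro ⟨u, v⟩ huv
      dsimp only
      split_ifs with hv
      · subst hv
        exact ha u (by rwa [mem_setX])
      · rfl)
    (by
      rintro z hz ⟨i, j⟩ hij
      rw [derivAt_of_fst]
      dsimp only
      split_ifs with hj
      · subst hj
        exact h0 _ (Finset.mem_image_of_mem _ hz) i (mem_setX.2 hij)
      · rfl)
  funext u
  simpa using congrFun this (u, 0)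

lemma TrivialKernel.axisY (h : TrivialKernel Z A S) :
    TrivialKernel1 (nodesY Z) (sliceY A 0) (setY S) := by
  intro a ha h0
  have := h (fun uv => if uv.1 = 0 then a uv.2 else 0)
    (by
      rintro ⟨u, v⟩ huv
      dsimp only
      split_ifs with hu
      · subst hu
        exact ha v (by rwa [mem_setY])
      · rfl)
    (by
      rintro z hz ⟨i, j⟩ hij
      rw [derivAt_of_snd]
      dsimp only
      split_ifs with hi
      · subst hi
        exact h0 _ (Finset.mem_image_of_mem _ hz) j (mem_sliceY.2 hij)
      · rfl)
  funext v
  simpa using congrFun this (0, v)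

lemma derivAt_product (U V : Finset ℕ) (a : ℕ × ℕ → ℝ) (i j : ℕ) (x y : ℝ) :
    derivAt (U ×ˢ V) a i j x y =
      derivAt1 V (fun v => derivAt1 U (fun u => a (u, v)) i x) j y := by
  simp only [derivAt, derivAt1, Finset.sum_product_right, Finset.sum_mul]
  exact Finset.sum_congr rfl fun _ _ => Finset.sum_congr rfl fun _ _ => by ring

lemma derivAt_mul (U V : Finset ℕ) (f g : ℕ → ℝ) (i j : ℕ) (x y : ℝ) :
    derivAt (U ×ˢ V) (fun uv => f uv.1 * g uv.2) i j x y =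
      derivAt1 U f i x * derivAt1 V g j y := by
  simp only [derivAt, derivAt1, Finset.sum_product, Finset.sum_mul_sum]
  exact Finset.sum_congr rfl fun _ _ => Finset.sum_congr rfl fun _ _ => by ring

/-- If the scheme `(X, B, U)` is regular and no order of `A` has its first coordinate outside `B`,
then triviality of the kernel passes from the product to each vertical line. -/
lemma TrivialKernel.verticalLine {X Y : Finset ℝ} {U V : Finset ℕ} (hX : X.Nonempty)
    (h : TrivialKernel (X ×ˢ Y) A (U ×ˢ V)) (hreg : Regular1 X B U)
    (hA : ∀ ij ∈ A, ij.1 ∈ B) {α : ℕ} (hα : α ∈ B) :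
    TrivialKernel1 Y (sliceY A α) V := by
  intro g hg h0
  obtain ⟨x₀, hx₀⟩ := hX
  obtain ⟨f, ⟨hf, hfc⟩, -⟩ := hreg fun i _ => if i = α then 1 else 0
  have hfg := h (fun uv => f uv.1 * g uv.2)
    (by
      rintro ⟨u, v⟩ huv
      by_cases hu : u ∈ U
      · have hv : v ∉ V := fun hv => huv (Finset.mk_mem_product hu hv)
        simp [hg v hv]
      · simp [hf u hu])
    (by
      rintro ⟨x, y⟩ hz ⟨i, j⟩ hij
      rw [Finset.mem_product] at hz
      rw [derivAt_mul, hfc x hz.1 i (hA _ hij)]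
      split_ifs with hi
      · subst hi
        rw [h0 y hz.2 j (mem_sliceY.2 hij), mul_zero]
      · exact zero_mul _)
  have hf0 : ∃ u, f u ≠ 0 := by
    by_contra! hf0
    simpa [derivAt1, hf0] using hfc x₀ hx₀ α hα
  obtain ⟨u, hu⟩ := hf0
  funext v
  exact (mul_eq_zero.1 (congrFun hfg (u, v))).resolve_left hu

lemma TrivialKernel.of_product {X Y : Finset ℝ} {U V : Finset ℕ}
    (hx : TrivialKernel1 X B U) (hy : ∀ α ∈ B, TrivialKernel1 Y (sliceY A α) V) :
    TrivialKernel (X ×ˢ Y) A (U ×ˢ V) := by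
  intro a ha h0
  have key : ∀ v, (fun u => a (u, v)) = 0 := fun v =>
    hx _ (fun u hu => ha _ fun h => hu (Finset.mem_product.1 h).1) fun x hxX i hi => by
      refine congrFun (hy i hi (fun v => derivAt1 U (fun u => a (u, v)) i x) ?_ ?_) v
      · intro v hv
        exact Finset.sum_eq_zero fun u _ => by
          simp [ha (u, v) fun h => hv (Finset.mem_product.1 h).2]
      · intro y hyY j hj
        rw [← derivAt_product]
        exact h0 (x, y) (Finset.mk_mem_product hxX hyY) (i, j) (mem_sliceY.1 hj)
  funext uv
  exact congrFun (key uv.2) uv.1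

end Kernels

lemma IsRect.eq_product {p q : ℕ} {Z : Finset (ℝ × ℝ)} (hZ : IsRect p q Z) :
    Z = nodesX Z ×ˢ nodesY Z ∧ (nodesX Z).card = p + 1 ∧ (nodesY Z).card = q + 1 := by
  classical
  obtain ⟨x, y, hx, hy, rfl⟩ := hZ
  have hX : nodesX ((univ : Finset (Fin (p + 1) × Fin (q + 1))).image
      fun ij => (x ij.1, y ij.2)) = univ.image x := by
    ext; simp [nodesX]
  have hY : nodesY ((univ : Finset (Fin (p + 1) × Fin (q + 1))).image
      fun ij => (x ij.1, y ij.2)) = univ.image y := by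
    ext; simp [nodesY]
  rw [hX, hY]
  refine ⟨?_, ?_, ?_⟩
  · ext ⟨a, b⟩
    simp
  · simp [Finset.card_image_of_injective _ hx]
  · simp [Finset.card_image_of_injective _ hy]

lemma IsLower.subset_product {S : Finset (ℕ × ℕ)} (hS : IsLower S) :
    S ⊆ Finset.range (setX S).card ×ˢ Finset.range (setY S).card := by
  rintro ⟨u, v⟩ huv
  have hu : Finset.range (u + 1) ⊆ setX S := fun i hi =>
    mem_setX.2 (hS u v huv i 0 (Nat.lt_succ_iff.1 (Finset.mem_range.1 hi)) (Nat.zero_le _))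
  have hv : Finset.range (v + 1) ⊆ setY S := fun j hj =>
    mem_setY.2 (hS u v huv 0 j (Nat.zero_le _) (Nat.lt_succ_iff.1 (Finset.mem_range.1 hj)))
  have hu' := Finset.card_le_card hu
  have hv' := Finset.card_le_card hv
  rw [Finset.card_range] at hu' hv'
  exact Finset.mk_mem_product (Finset.mem_range.2 hu') (Finset.mem_range.2 hv')

lemma setX_range_product {m n : ℕ} (hn : 0 < n) :
    setX (Finset.range m ×ˢ Finset.range n) = Finset.range m := by
  ext u
  simp [mem_setX, hn]

lemma setY_range_product {m n : ℕ} (hm : 0 < m) :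
    setY (Finset.range m ×ˢ Finset.range n) = Finset.range n := by
  ext v
  simp [mem_setY, hm]

lemma card_sliceY (A : Finset (ℕ × ℕ)) (a : ℕ) :
    (sliceY A a).card = (A.filter fun ij => ij.1 = a).card := by
  refine Finset.card_image_of_injOn ?_
  rintro ⟨u, v⟩ h ⟨u', v'⟩ h' hvv
  simp_all

lemma setX_subset_image_fst (A : Finset (ℕ × ℕ)) : setX A ⊆ A.image Prod.fst :=
  Finset.image_subset_image (Finset.filter_subset _ _)

/-- if the lower set `S_y(A)` associated to `A` is the rectangle
`R(s,t)` (i.e. `A` has `s+1` distinct first coordinates and exactly `t+1`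
elements on each of the corresponding vertical lines), then `(Z,A,S)` is
regular iff (i) `S = R((s+1)(p+1)-1, (t+1)(q+1)-1)`, (ii) `(Z_x,A_x,S_x)` is
regular, and (iii) every `(Z_y, A_y[α], S_y)` with `α ∈ A_x` is regular. -/
theorem rectangular_SyA (p q s t : ℕ) (Z : Finset (ℝ × ℝ)) (A S : Finset (ℕ × ℕ))
    (hZ : IsRect p q Z) (hS : IsLower S) (hnorm : S.card = Z.card * A.card)
    (hSyA₁ : (A.image Prod.fst).card = s + 1)
    (hSyA₂ : ∀ a ∈ A.image Prod.fst, (A.filter fun ij => ij.1 = a).card = t + 1) :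
    Regular Z A S ↔
      (S = rect ((s + 1) * (p + 1) - 1) ((t + 1) * (q + 1) - 1) ∧
       Regular1 (nodesX Z) (setX A) (setX S) ∧
       ∀ a ∈ setX A, Regular1 (nodesY Z) (sliceY A a) (setY S)) := by
  obtain ⟨hZXY, hcX, hcY⟩ := hZ.eq_product
  have hm : 0 < (s + 1) * (p + 1) := by positivity
  have hn : 0 < (t + 1) * (q + 1) := by positivity
  have hrect : rect ((s + 1) * (p + 1) - 1) ((t + 1) * (q + 1) - 1) =
      Finset.range ((s + 1) * (p + 1)) ×ˢ Finset.range ((t + 1) * (q + 1)) := by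
    rw [rect, Nat.sub_add_cancel hm, Nat.sub_add_cancel hn]
  rw [hrect]
  have hcA : A.card = (s + 1) * (t + 1) := by
    rw [Finset.card_eq_sum_card_image Prod.fst A, Finset.sum_congr rfl hSyA₂, Finset.sum_const,
      hSyA₁, smul_eq_mul]
  have hcZ : Z.card = (p + 1) * (q + 1) := by
    rw [hZXY, Finset.card_product, hcX, hcY]
  constructor
  · intro hreg
    have hker := hreg.trivialKernel
    have hAx : (setX A).card ≤ s + 1 := hSyA₁ ▸ Finset.card_le_card (setX_subset_image_fst A)
    have hA0 : (sliceY A 0).card ≤ t + 1 := by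
      rw [card_sliceY]
      by_cases h0 : 0 ∈ A.image Prod.fst
      · exact (hSyA₂ 0 h0).le
      · rw [Finset.filter_eq_empty_iff.2 fun ij hij h =>
          h0 (Finset.mem_image.2 ⟨ij, hij, h⟩)]
        exact Nat.zero_le _
    have hSx := hker.axisX.card_le
    have hSy := hker.axisY.card_le
    rw [hcX] at hSx
    rw [hcY] at hSy
    have hSeq : S = Finset.range ((s + 1) * (p + 1)) ×ˢ Finset.range ((t + 1) * (q + 1)) := by
      refine Finset.eq_of_subset_of_card_le (hS.subset_product.trans
        (Finset.product_subset_product (Finset.range_subset_range.2 ?_)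
          (Finset.range_subset_range.2 ?_))) ?_
      · rw [mul_comm (s + 1)]
        exact hSx.trans (Nat.mul_le_mul_left _ hAx)
      · rw [mul_comm (t + 1)]
        exact hSy.trans (Nat.mul_le_mul_left _ hA0)
      · rw [hnorm, hcZ, hcA, Finset.card_product, Finset.card_range, Finset.card_range]
        exact le_of_eq (by ring)
    have hSX : setX S = Finset.range ((s + 1) * (p + 1)) := by
      rw [hSeq, setX_range_product hn]
    have hSY : setY S = Finset.range ((t + 1) * (q + 1)) := by
      rw [hSeq, setY_range_product hm]
    have hAx' : (setX A).card = s + 1 := by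
      refine le_antisymm hAx ?_
      rw [hSX, Finset.card_range, mul_comm] at hSx
      exact Nat.le_of_mul_le_mul_left hSx (Nat.succ_pos p)
    have hAimage : setX A = A.image Prod.fst :=
      Finset.eq_of_subset_of_card_le (setX_subset_image_fst A) (by rw [hSyA₁, hAx'])
    have hregX : Regular1 (nodesX Z) (setX A) (setX S) := hker.axisX.regular1 (by
      rw [hSX, Finset.card_range, hcX, hAx', mul_comm])
    refine ⟨hSeq, hregX, fun a ha => ?_⟩
    have hkerXY : TrivialKernel (nodesX Z ×ˢ nodesY Z) A (setX S ×ˢ setY S) := by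
      rwa [← hZXY, hSX, hSY, ← hSeq]
    refine (hkerXY.verticalLine (Finset.card_pos.1 (by omega)) hregX
      (fun ij hij => hAimage ▸ Finset.mem_image_of_mem _ hij) ha).regular1 ?_
    rw [hSY, Finset.card_range, hcY, card_sliceY, hSyA₂ a (hAimage ▸ ha), mul_comm]
  · rintro ⟨hSeq, hx, hy⟩
    refine TrivialKernel.regular ?_ hnorm
    have hker := TrivialKernel.of_product hx.trivialKernel1 fun a ha => (hy a ha).trivialKernel1
    rwa [← hZXY, hSeq, setX_range_product hn, setY_range_product hm, ← hSeq] at hker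
end

section
/- Let (Z,A,S) be a normal regular bivariate Birkhoff interpolation scheme in which Z is (p,q)-rectangular, and set p' = (p+1)|A_x| − 1 and q' = (q+1)|A_y| − 1. Then S_x[0] = S_x[1] = … = S_x[q] = {0,1,…,p'} and S_y[0] = S_y[1] = … = S_y[p] = {0,1,…,q'}. -/
open Finset

theorem mem_sliceX {B : Finset (ℕ × ℕ)} {a b : ℕ} : a ∈ sliceX B b ↔ (a, b) ∈ B := by
  simp [sliceX]

theorem mem_sliceY_s8 {B : Finset (ℕ × ℕ)} {a b : ℕ} : b ∈ sliceY B a ↔ (a, b) ∈ B := by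
  simp [sliceY]

theorem mem_setX_s8 {B : Finset (ℕ × ℕ)} {a : ℕ} : a ∈ setX B ↔ (a, 0) ∈ B := by
  simp [setX]

theorem mem_setY_s8 {B : Finset (ℕ × ℕ)} {b : ℕ} : b ∈ setY B ↔ (0, b) ∈ B := by
  simp [setY]

theorem card_sliceX (B : Finset (ℕ × ℕ)) (b : ℕ) :
    (sliceX B b).card = (B.filter fun ij => ij.2 = b).card := by
  refine card_image_of_injOn ?_
  rintro ⟨u, v⟩ h ⟨u', v'⟩ h' huu
  exact Prod.ext huu ((mem_filter.1 h).2.trans (mem_filter.1 h').2.symm)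

/-- A downward closed finite set of naturals is an initial segment. -/
theorem eq_range_card_of_isLower {s : Finset ℕ} (h : ∀ m ∈ s, ∀ k ≤ m, k ∈ s) :
    s = range s.card := by
  refine eq_of_subset_of_card_le (fun m hm => mem_range.2 ?_) (by simp)
  have hsub : range (m + 1) ⊆ s := fun k hk => h m hm k (Nat.lt_succ_iff.1 (mem_range.1 hk))
  simpa using card_le_card hsub

/-- On `q + 1` nodes, every power agrees with a combination of the powers of degree at most `q`,
using no power of larger degree than the original one. -/
theorem exists_pow_eq_sum_pow {q : ℕ} (y : Fin (q + 1) → ℝ) (v : ℕ) :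
    ∃ r : ℕ → ℝ, (∀ w, v < w → r w = 0) ∧
      ∀ l, y l ^ v = ∑ w ∈ range (q + 1), r w * y l ^ w := by
  rcases Nat.lt_or_ge v (q + 1) with hv | hv
  · refine ⟨fun w => if w = v then 1 else 0, fun w hw => if_neg hw.ne', fun l => ?_⟩
    simp [hv]
  · set M : Polynomial ℝ := ∏ l, (Polynomial.X - Polynomial.C (y l)) with hM
    have hmonic : M.Monic := Polynomial.monic_prod_of_monic _ _ fun l _ => Polynomial.monic_X_sub_C _
    have hdeg : M.natDegree = q + 1 := by
      rw [hM, Polynomial.natDegree_prod_of_monic _ _ fun l _ => Polynomial.monic_X_sub_C _]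
      simp
    have hlt : ((Polynomial.X ^ v : Polynomial ℝ) %ₘ M).natDegree < q + 1 := by
      rw [← hdeg]
      refine Polynomial.natDegree_modByMonic_lt _ hmonic fun h1 => ?_
      simp [h1] at hdeg
    refine ⟨fun w => ((Polynomial.X ^ v : Polynomial ℝ) %ₘ M).coeff w, fun w hw => ?_, fun l => ?_⟩
    · exact Polynomial.coeff_eq_zero_of_natDegree_lt (hlt.trans_le (hv.trans hw.le))
    · have hroot : M.eval (y l) = 0 := by
        rw [hM, Polynomial.eval_prod]
        exact prod_eq_zero (mem_univ l) (by simp)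
      have h := congrArg (Polynomial.eval (y l))
        (Polynomial.modByMonic_add_div (Polynomial.X ^ v : Polynomial ℝ) M)
      rw [Polynomial.eval_add, Polynomial.eval_mul, hroot, zero_mul, add_zero] at h
      rw [← Polynomial.eval_eq_sum_range' hlt, h]
      simp

/-- Uniqueness bounds the number of monomials in `x` alone. -/
theorem card_sliceX_zero_le {p q : ℕ} {A S : Finset (ℕ × ℕ)}
    (x : Fin (p + 1) → ℝ) (y : Fin (q + 1) → ℝ)
    (hreg : Regular (univ.image fun ij : Fin (p + 1) × Fin (q + 1) => (x ij.1, y ij.2)) A S) :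
    (sliceX S 0).card ≤ (p + 1) * (setX A).card := by
  set T := S.filter fun ij => ij.2 = 0
  let e : ℕ × ℕ → (Fin (p + 1) × setX A → ℝ) := fun uv ki =>
    (uv.1.descFactorial ki.2 : ℝ) * x ki.1 ^ (uv.1 - ki.2)
  have hli : LinearIndepOn ℝ e (T : Set (ℕ × ℕ)) := by
    rw [linearIndepOn_finset_iff]
    intro g hg uv huv
    let a : ℕ × ℕ → ℝ := fun uv => if uv ∈ T then g uv else 0
    have ha : (∀ uv, uv ∉ S → a uv = 0) ∧
        ∀ z ∈ univ.image fun ij : Fin (p + 1) × Fin (q + 1) => (x ij.1, y ij.2),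
          ∀ ij ∈ A, derivAt S a ij.1 ij.2 z.1 z.2 = 0 := by
      refine ⟨fun uv h => if_neg fun h' => h (mem_filter.1 h').1, fun z hz ij hij => ?_⟩
      obtain ⟨⟨k, l⟩, -, rfl⟩ := mem_image.1 hz
      obtain ⟨i, j⟩ := ij
      have hsum : derivAt S a i j (x k) (y l) = ∑ uv ∈ T, g uv * (uv.1.descFactorial i : ℝ) *
          (uv.2.descFactorial j : ℝ) * x k ^ (uv.1 - i) * y l ^ (uv.2 - j) := by
        rw [derivAt, ← sum_subset (filter_subset _ _ : T ⊆ S)]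
        · exact sum_congr rfl fun uv h => by simp only [a, if_pos h]
        · intro uv _ h
          rw [show a uv = 0 from if_neg h]
          simp only [zero_mul]
      rw [hsum]
      rcases Nat.eq_zero_or_pos j with rfl | hj
      · have h := congrFun hg (k, ⟨i, mem_setX_s8.2 hij⟩)
        simp only [Finset.sum_apply, Pi.smul_apply, smul_eq_mul, Pi.zero_apply, e] at h
        rw [← h]
        refine sum_congr rfl fun uv h => ?_
        rw [(mem_filter.1 h).2]
        simp [mul_assoc]
      · refine sum_eq_zero fun uv h => ?_
        rw [(mem_filter.1 h).2, Nat.descFactorial_of_lt hj]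
        simp
    have h0 := (hreg fun _ _ => 0).unique ha
      (y₂ := 0) ⟨fun _ _ => rfl, fun z _ ij _ => by simp [derivAt]⟩
    have := congrFun h0 uv
    simpa [a, huv] using this
  have h := LinearIndependent.fintype_card_le_finrank hli
  rw [card_sliceX]
  simpa [Module.finrank_fintype_fun_eq_card] using h

/-- Existence bounds from below the number of monomials of degree at most `q` in `y`. -/
theorem le_card_filter_snd_le {p q : ℕ} {A S : Finset (ℕ × ℕ)} (hS : IsLower S)
    (x : Fin (p + 1) → ℝ) (y : Fin (q + 1) → ℝ)
    (hx : Function.Injective x) (hy : Function.Injective y)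
    (hreg : Regular (univ.image fun ij : Fin (p + 1) × Fin (q + 1) => (x ij.1, y ij.2)) A S) :
    (q + 1) * ((p + 1) * (setX A).card) ≤ (S.filter fun ij => ij.2 < q + 1).card := by
  set T := S.filter fun ij => ij.2 < q + 1
  let I := Fin (p + 1) × Fin (q + 1) × setX A
  let e : ℕ × ℕ → (I → ℝ) := fun uv t =>
    (uv.1.descFactorial t.2.2 : ℝ) * x t.1 ^ (uv.1 - t.2.2) * y t.2.1 ^ uv.2
  have hmem : ∀ uv ∈ S, e uv ∈ Submodule.span ℝ (T.image e : Set (I → ℝ)) := by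
    rintro ⟨u, v⟩ huv
    obtain ⟨r, hr, hsum⟩ := exists_pow_eq_sum_pow y v
    have he : e (u, v) = ∑ w ∈ range (q + 1), r w • e (u, w) := by
      ext t
      simp only [e, Finset.sum_apply, Pi.smul_apply, smul_eq_mul, hsum, mul_sum]
      exact sum_congr rfl fun w _ => by ring
    rw [he]
    refine Submodule.sum_mem _ fun w hw => ?_
    rcases Nat.lt_or_ge v w with hvw | hvw
    · rw [hr w hvw, zero_smul]
      exact Submodule.zero_mem _
    · refine Submodule.smul_mem _ _ (Submodule.subset_span ?_)
      exact mem_coe.2 (mem_image_of_mem e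
        (mem_filter.2 ⟨hS u v huv u w le_rfl hvw, mem_range.1 hw⟩))
  have htop : Submodule.span ℝ (T.image e : Set (I → ℝ)) = ⊤ := by
    rw [eq_top_iff]
    rintro c -
    let ι : I → (ℕ × ℕ) × (ℝ × ℝ) := fun t => ((t.2.2, 0), (x t.1, y t.2.1))
    have hι : Function.Injective ι := by
      rintro ⟨k, l, i⟩ ⟨k', l', i'⟩ h
      simp only [ι, Prod.mk.injEq, and_true] at h
      obtain ⟨hi, hk, hl⟩ := h
      rw [hx hk, hy hl, Subtype.ext hi]
    obtain ⟨a, ⟨-, ha⟩, -⟩ := hreg fun ij z => Function.extend ι c 0 (ij, z)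
    have hc : c = ∑ uv ∈ S, a uv • e uv := by
      ext t
      have h := ha (x t.1, y t.2.1) (mem_image.2 ⟨(t.1, t.2.1), mem_univ _, rfl⟩)
        (t.2.2, 0) (mem_setX_s8.1 t.2.2.2)
      rw [← hι.extend_apply c 0 t, ← h, derivAt]
      simp only [Finset.sum_apply, Pi.smul_apply, smul_eq_mul, e]
      exact sum_congr rfl fun uv _ => by simp [mul_assoc]
    rw [hc]
    exact Submodule.sum_mem _ fun uv h => Submodule.smul_mem _ _ (hmem uv h)
  have h := (finrank_span_finset_le_card (R := ℝ) (T.image e)).trans card_image_le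
  rw [Set.finrank, htop, finrank_top, Module.finrank_fintype_fun_eq_card] at h
  have hI : Fintype.card I = (q + 1) * ((p + 1) * (setX A).card) := by
    simp only [I, Fintype.card_prod, Fintype.card_fin, Fintype.card_coe]
    ring
  rwa [hI] at h

theorem sliceX_eq_range {p q : ℕ} {Z : Finset (ℝ × ℝ)} {A S : Finset (ℕ × ℕ)}
    (hZ : IsRect p q Z) (hS : IsLower S) (hreg : Regular Z A S) {j : ℕ} (hj : j ≤ q) :
    sliceX S j = range ((p + 1) * (setX A).card) := by
  obtain ⟨x, y, hx, hy, rfl⟩ := hZ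
  have hle : ∀ i ∈ range (q + 1), (sliceX S i).card ≤ (p + 1) * (setX A).card := fun i _ =>
    (card_le_card fun u hu => mem_sliceX.2
      (hS u i (mem_sliceX.1 hu) u 0 le_rfl i.zero_le)).trans (card_sliceX_zero_le x y hreg)
  have hsum : (S.filter fun ij => ij.2 < q + 1).card =
      ∑ i ∈ range (q + 1), (sliceX S i).card := by
    rw [card_eq_sum_card_fiberwise (f := Prod.snd) (t := range (q + 1))
      fun uv h => by simpa using (mem_filter.1 h).2]
    refine sum_congr rfl fun i hi => ?_
    rw [card_sliceX, filter_filter]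
    congr 1
    refine filter_congr fun uv _ => ⟨And.right, fun h => ⟨h ▸ mem_range.1 hi, h⟩⟩
  have hge := le_card_filter_snd_le hS x y hx hy hreg
  have heq := (sum_eq_sum_iff_of_le hle).1 (le_antisymm (sum_le_sum hle)
    (by rw [← hsum, sum_const, card_range, smul_eq_mul]; exact hge))
  rw [← heq j (mem_range.2 (Nat.lt_succ_of_le hj))]
  exact eq_range_card_of_isLower fun m hm k hk =>
    mem_sliceX.2 (hS m j (mem_sliceX.1 hm) k j hk le_rfl)

theorem mem_image_swap {α β : Type*} [DecidableEq α] [DecidableEq β] {B : Finset (α × β)}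
    {z : β × α} : z ∈ B.image Prod.swap ↔ z.swap ∈ B := by
  rw [mem_image]
  exact ⟨by rintro ⟨w, hw, rfl⟩; simpa using hw, fun h => ⟨_, h, z.swap_swap⟩⟩

theorem derivAt_image_swap (S : Finset (ℕ × ℕ)) (a : ℕ × ℕ → ℝ) (i j : ℕ) (x y : ℝ) :
    derivAt (S.image Prod.swap) a i j x y = derivAt S (a ∘ Prod.swap) j i y x := by
  rw [derivAt, sum_image Prod.swap_injective.injOn, derivAt]
  exact sum_congr rfl fun uv _ => by simp only [Prod.fst_swap, Prod.snd_swap, Function.comp]; ring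

theorem IsLower.image_swap {S : Finset (ℕ × ℕ)} (hS : IsLower S) :
    IsLower (S.image Prod.swap) := fun u v h i j hi hj =>
  mem_image_swap.2 (hS v u (mem_image_swap.1 h) j i hj hi)

theorem IsRect.image_swap {p q : ℕ} {Z : Finset (ℝ × ℝ)} (hZ : IsRect p q Z) :
    IsRect q p (Z.image Prod.swap) := by
  obtain ⟨x, y, hx, hy, rfl⟩ := hZ
  refine ⟨y, x, hy, hx, ?_⟩
  ext ⟨s, t⟩
  rw [mem_image_swap]
  simp [and_comm]

theorem Regular.image_swap {Z : Finset (ℝ × ℝ)} {A S : Finset (ℕ × ℕ)} (h : Regular Z A S) :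
    Regular (Z.image Prod.swap) (A.image Prod.swap) (S.image Prod.swap) := by
  intro c
  obtain ⟨a, ⟨ha, ha'⟩, huniq⟩ := h fun ij z => c ij.swap z.swap
  refine ⟨a ∘ Prod.swap, ⟨fun uv huv => ha _ fun h' => huv (mem_image_swap.2 h'),
    fun z hz ij hij => ?_⟩, ?_⟩
  · rw [derivAt_image_swap]
    exact ha' z.swap (mem_image_swap.1 hz) ij.swap (mem_image_swap.1 hij)
  · rintro b ⟨hb, hb'⟩
    have hba : b ∘ Prod.swap = a := by
      refine huniq _ ⟨fun uv huv => hb _ fun h' => huv ?_, fun z hz ij hij => ?_⟩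
      · simpa using mem_image_swap.1 h'
      · rw [← derivAt_image_swap]
        exact hb' z.swap (mem_image_of_mem _ hz) ij.swap (mem_image_of_mem _ hij)
    rw [← hba]
    rfl

/-- a normal regular scheme with `(p,q)`-rectangular nodes has
`S_x[0] = … = S_x[q] = {0,…,p'}` and `S_y[0] = … = S_y[p] = {0,…,q'}`, where
`p' + 1 = (p+1)|A_x|` and `q' + 1 = (q+1)|A_y|`. -/
theorem shape_around_axes (p q : ℕ) (Z : Finset (ℝ × ℝ)) (A S : Finset (ℕ × ℕ))
    (hZ : IsRect p q Z) (hS : IsLower S) (hnorm : S.card = Z.card * A.card)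
    (hreg : Regular Z A S) :
    (∀ j ≤ q, sliceX S j = Finset.range ((p + 1) * (setX A).card)) ∧
    (∀ i ≤ p, sliceY S i = Finset.range ((q + 1) * (setY A).card)) := by
  refine ⟨fun j hj => sliceX_eq_range hZ hS hreg hj, fun i hi => ?_⟩
  have h := sliceX_eq_range hZ.image_swap hS.image_swap hreg.image_swap hi
  have hA : setX (A.image Prod.swap) = setY A := by
    ext j
    rw [mem_setX_s8, mem_setY_s8, mem_image_swap, Prod.swap_prod_mk]
  rw [hA] at h
  rw [← h]
  ext j
  rw [mem_sliceX, mem_sliceY_s8, mem_image_swap, Prod.swap_prod_mk]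
end
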